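/- For each n ≥ 1, let k = k(n) ≥ 2 and let d_1(n), …, d_k(n) ≥ 1 be integers with d_i·n even for each i and with sum D = D(n) satisfying D^3 ≤ n; let η_n and η̃_n be probability measures on 𝒢_{d_1}(n), and set τ_n = μ_{d_2,n} ⊕ ⋯ ⊕ μ_{d_k,n}. If the sequences (η_n)_{n≥1} and (η̃_n)_{n≥1} are contiguous, then the sequences (η_n ⊕ τ_n)_{n≥1} and (η̃_n ⊕ τ_n)_{n≥1} are contiguous as well. -/

import Mathlib

open Filter Topology

/-- Degree of a vertex in a graph on `Fin n`. -/
noncomputable def gDeg {n : ℕ} (G : SimpleGraph (Fin n)) (v : Fin n) : ℕ :=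
  Nat.card {w : Fin n // G.Adj v w}

/-- `G` is a `d`-regular graph. -/
def IsRegularGraph {n : ℕ} (G : SimpleGraph (Fin n)) (d : ℕ) : Prop :=
  ∀ v, gDeg G v = d

open scoped Classical in
/-- The uniform probability distribution `μ_{d,n}` on the `d`-regular graphs on `{1,…,n}`. -/
noncomputable def mu (n d : ℕ) : SimpleGraph (Fin n) → ℝ := fun G =>
  if IsRegularGraph G d then
    (Nat.card {H : SimpleGraph (Fin n) // IsRegularGraph H d} : ℝ)⁻¹
  else 0

/-- `p` is a probability distribution on a finite or countable space. -/
def IsProbC {α : Type*} (p : α → ℝ) : Prop :=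
  (∀ x, 0 ≤ p x) ∧ ∑' x, p x = 1

/-- Probability of an event `A` under the distribution `p`. -/
noncomputable def probOf {α : Type*} (p : α → ℝ) (A : Set α) : ℝ := ∑' x : A, p x

/-- Total variation distance. -/
noncomputable def tvDist {α : Type*} (p q : α → ℝ) : ℝ := (1/2) * ∑' x, |p x - q x|

/-- `π` is a coupling of `p` and `q`. -/
def IsCoupling {α β : Type*} (π : α × β → ℝ) (p : α → ℝ) (q : β → ℝ) : Prop :=
  IsProbC π ∧ (∀ a, ∑' b, π (a, b) = p a) ∧ (∀ b, ∑' a, π (a, b) = q b)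

/-- Expectation of `f` under the distribution `p`. -/
noncomputable def expec {α : Type*} (p f : α → ℝ) : ℝ := ∑' x, p x * f x

open scoped Classical in
/-- Unnormalised mass of `p ⊕ q` at `G`: sum over ordered pairs of edge-disjoint graphs
with union `G`. -/
noncomputable def oplusMass {n : ℕ} (p q : SimpleGraph (Fin n) → ℝ)
    (G : SimpleGraph (Fin n)) : ℝ :=
  ∑' H : SimpleGraph (Fin n) × SimpleGraph (Fin n),
    if Disjoint H.1 H.2 ∧ H.1 ⊔ H.2 = G then p H.1 * q H.2 else 0

/-- The distribution `p ⊕ q`. -/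
noncomputable def oplus {n : ℕ} (p q : SimpleGraph (Fin n) → ℝ) :
    SimpleGraph (Fin n) → ℝ :=
  fun G => oplusMass p q G / ∑' H, oplusMass p q H

open scoped Classical in
/-- Unnormalised mass of the `k`-fold sum `p 0 ⊕ ⋯ ⊕ p (k-1)` at `G`: sum over ordered
`k`-tuples of pairwise edge-disjoint graphs with union `G`. -/
noncomputable def oplusFoldMass {n : ℕ} (k : ℕ) (p : Fin k → SimpleGraph (Fin n) → ℝ)
    (G : SimpleGraph (Fin n)) : ℝ :=
  ∑' f : Fin k → SimpleGraph (Fin n),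
    if (∀ i j, i ≠ j → Disjoint (f i) (f j)) ∧ (⨆ i, f i) = G then
      ∏ i, p i (f i)
    else 0

/-- The `k`-fold distribution `p 0 ⊕ ⋯ ⊕ p (k-1)`. -/
noncomputable def oplusFold {n : ℕ} (k : ℕ) (p : Fin k → SimpleGraph (Fin n) → ℝ) :
    SimpleGraph (Fin n) → ℝ :=
  fun G => oplusFoldMass k p G / ∑' H, oplusFoldMass k p H

/-- Two sequences of probability measures are contiguous. -/
def Contiguous {Ω : ℕ → Type*} (p q : (n : ℕ) → Ω n → ℝ) : Prop :=
  ∀ A : (n : ℕ) → Set (Ω n),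
    (Tendsto (fun n => probOf (p n) (A n)) atTop (𝓝 1) ↔
     Tendsto (fun n => probOf (q n) (A n)) atTop (𝓝 1))

section Switching

open Finset
open scoped Classical symmDiff

variable {n : ℕ}

/-- The `4`-cycle graph with edges `ab`, `ce`, `ac`, `be`. -/
def fourCycle (a b c e : Fin n) : SimpleGraph (Fin n) :=
  SimpleGraph.fromEdgeSet {s(a, b), s(c, e), s(a, c), s(b, e)}

/-- The `d`-regular graphs that are edge-disjoint from `X` and contain all edges in `S`. -/
noncomputable def regularAvoiding (d : ℕ) (X : SimpleGraph (Fin n)) (S : Finset (Sym2 (Fin n))) :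
    Finset (SimpleGraph (Fin n)) :=
  univ.filter fun G => IsRegularGraph G d ∧ Disjoint X G ∧ ∀ e ∈ S, e ∈ G.edgeSet

lemma gDeg_eq_card_filter (G : SimpleGraph (Fin n)) (v : Fin n) :
    gDeg G v = (univ.filter fun w => G.Adj v w).card := by
  simp [gDeg, Fintype.card_subtype]

lemma disjoint_iff_forall_adj {X G : SimpleGraph (Fin n)} :
    Disjoint X G ↔ ∀ v w, X.Adj v w → ¬ G.Adj v w := by
  rw [disjoint_iff]
  constructor
  · intro h v w h1 h2
    have : (X ⊓ G).Adj v w := ⟨h1, h2⟩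
    rw [h] at this
    exact this
  · intro h
    ext v w
    simp only [SimpleGraph.inf_adj, SimpleGraph.bot_adj, iff_false, not_and]
    exact h v w

lemma symmDiff_adj (G C : SimpleGraph (Fin n)) (v w : Fin n) :
    (G ∆ C).Adj v w ↔ Xor (G.Adj v w) (C.Adj v w) := by
  simp [symmDiff_def, Xor]

lemma card_filter_xor {p q : Fin n → Prop} {u v : Fin n} (hq : ∀ w, q w ↔ w = u ∨ w = v)
    (hu : p u) (hv : ¬ p v) :
    (univ.filter fun w => Xor (p w) (q w)).card = (univ.filter p).card := by
  have h : (univ.filter fun w => Xor (p w) (q w)) = insert v ((univ.filter p).erase u) := by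
    ext w
    simp only [mem_filter, mem_univ, true_and, mem_insert, mem_erase, Xor, hq]
    by_cases h1 : w = u <;> by_cases h2 : w = v <;> grind
  rw [h, card_insert_of_notMem (by simp [hv]), card_erase_of_mem (by simp [hu])]
  have : 0 < (univ.filter p).card := card_pos.2 ⟨u, by simp [hu]⟩
  omega

lemma fourCycle_adj {a b c e : Fin n} (hab : a ≠ b) (hac : a ≠ c) (hbe : b ≠ e) (hce : c ≠ e)
    (v w : Fin n) :
    (fourCycle a b c e).Adj v w ↔
      (v = a ∧ (w = b ∨ w = c)) ∨ (v = b ∧ (w = a ∨ w = e)) ∨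
      (v = c ∧ (w = e ∨ w = a)) ∨ (v = e ∧ (w = c ∨ w = b)) := by
  simp only [fourCycle, SimpleGraph.fromEdgeSet_adj, Set.mem_insert_iff, Set.mem_singleton_iff,
    Sym2.eq_iff]
  grind

lemma IsRegularGraph.symmDiff_fourCycle {G : SimpleGraph (Fin n)} {d : ℕ}
    (hG : IsRegularGraph G d) {a b c e : Fin n} (hac : a ≠ c) (hbe : b ≠ e)
    (h1 : G.Adj a b) (h2 : G.Adj c e) (h3 : ¬ G.Adj a c) (h4 : ¬ G.Adj b e) :
    IsRegularGraph (G ∆ fourCycle a b c e) d := by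
  have hab := h1.ne
  have hce := h2.ne
  have hae : a ≠ e := by rintro rfl; exact h3 h2.symm
  have hbc : b ≠ c := by rintro rfl; exact h4 h2
  have h1' := h1.symm
  have h2' := h2.symm
  have h3' : ¬ G.Adj c a := fun h => h3 h.symm
  have h4' : ¬ G.Adj e b := fun h => h4 h.symm
  intro v
  rw [← hG v, gDeg_eq_card_filter, gDeg_eq_card_filter]
  simp only [symmDiff_adj]
  by_cases va : v = a
  · subst va
    refine card_filter_xor (q := (fourCycle v b c e).Adj v)
      (u := b) (v := c) (fun w => ?_) h1 h3
    rw [fourCycle_adj hab hac hbe hce]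
    grind
  by_cases vb : v = b
  · subst vb
    refine card_filter_xor (q := (fourCycle a v c e).Adj v)
      (u := a) (v := e) (fun w => ?_) h1' h4
    rw [fourCycle_adj hab hac hbe hce]
    grind
  by_cases vc : v = c
  · subst vc
    refine card_filter_xor (q := (fourCycle a b v e).Adj v)
      (u := e) (v := a) (fun w => ?_) h2 h3'
    rw [fourCycle_adj hab hac hbe hce]
    grind
  by_cases ve : v = e
  · subst ve
    refine card_filter_xor (q := (fourCycle a b c v).Adj v)
      (u := c) (v := b) (fun w => ?_) h2' h4'
    rw [fourCycle_adj hab hac hbe hce]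
    grind
  simp [fourCycle_adj hab hac hbe hce, va, vb, vc, ve, Xor]

lemma card_darts_from {G : SimpleGraph (Fin n)} {d : ℕ} (hG : IsRegularGraph G d)
    (B : Finset (Fin n)) :
    (univ.filter fun p : Fin n × Fin n => p.1 ∈ B ∧ G.Adj p.1 p.2).card = B.card * d := by
  have h : (univ.filter fun p : Fin n × Fin n => p.1 ∈ B ∧ G.Adj p.1 p.2) =
      (B.sigma fun c => univ.filter fun e => G.Adj c e).map
        (Equiv.sigmaEquivProd (Fin n) (Fin n)).toEmbedding := by
    ext ⟨c, e⟩
    simp [Equiv.sigmaEquivProd]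
  rw [h, card_map, card_sigma, ← smul_eq_mul, ← sum_const]
  refine sum_congr rfl fun c _ => ?_
  rw [← gDeg_eq_card_filter, hG c]

lemma card_darts_to {G : SimpleGraph (Fin n)} {d : ℕ} (hG : IsRegularGraph G d)
    (B : Finset (Fin n)) :
    (univ.filter fun p : Fin n × Fin n => p.2 ∈ B ∧ G.Adj p.1 p.2).card = B.card * d := by
  rw [← card_darts_from hG B]
  refine card_bij' (fun p _ => p.swap) (fun p _ => p.swap) ?_ ?_ ?_ ?_ <;>
    simp +contextual [SimpleGraph.adj_comm]

lemma card_pairs_mem_le (S : Finset (Sym2 (Fin n))) :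
    (univ.filter fun p : Fin n × Fin n => s(p.1, p.2) ∈ S).card ≤ 2 * S.card := by
  have h : (univ.filter fun p : Fin n × Fin n => s(p.1, p.2) ∈ S) ⊆
      S.biUnion fun s => univ.filter fun p : Fin n × Fin n => s(p.1, p.2) = s := by
    intro p hp
    simpa using hp
  refine (card_le_card h).trans (card_biUnion_le.trans ?_)
  rw [mul_comm, ← smul_eq_mul, ← sum_const]
  refine sum_le_sum fun s _ => ?_
  induction s using Sym2.ind with
  | _ u v =>
    refine (card_le_card (t := {(u, v), (v, u)}) ?_).trans card_le_two
    rintro ⟨p, q⟩ hp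
    simpa [Sym2.eq_iff] using hp

lemma mem_regularAvoiding {d : ℕ} {X : SimpleGraph (Fin n)} {S : Finset (Sym2 (Fin n))}
    {G : SimpleGraph (Fin n)} :
    G ∈ regularAvoiding d X S ↔
      IsRegularGraph G d ∧ Disjoint X G ∧ ∀ e ∈ S, e ∈ G.edgeSet := by
  simp [regularAvoiding]

/-- The number of choices of an edge `ce` for which the edges `ab` and `ce` of `G` can be
switched to `ac` and `be`. -/
lemma card_switchable_ge {d x D : ℕ} {X G : SimpleGraph (Fin n)} (hX : ∀ v, gDeg X v ≤ x)
    (hG : IsRegularGraph G d) {S : Finset (Sym2 (Fin n))} (hS : S.card ≤ 2)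
    (hd : 1 ≤ d) (hD : d + x ≤ D) (a b : Fin n) :
    n * d ≤ (univ.filter fun p : Fin n × Fin n => G.Adj p.1 p.2 ∧
      (¬ G.Adj a p.1 ∧ p.1 ≠ a ∧ ¬ X.Adj a p.1) ∧
      (¬ G.Adj b p.2 ∧ p.2 ≠ b ∧ ¬ X.Adj b p.2) ∧ s(p.1, p.2) ∉ S).card + 8 * D * d := by
  set good := (univ.filter fun p : Fin n × Fin n => G.Adj p.1 p.2 ∧
      (¬ G.Adj a p.1 ∧ p.1 ≠ a ∧ ¬ X.Adj a p.1) ∧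
      (¬ G.Adj b p.2 ∧ p.2 ≠ b ∧ ¬ X.Adj b p.2) ∧ s(p.1, p.2) ∉ S)
  let B : Fin n → Finset (Fin n) := fun v =>
    (univ.filter fun w => G.Adj v w) ∪ {v} ∪ (univ.filter fun w => X.Adj v w)
  have hB : ∀ v, (B v).card ≤ D + 1 := by
    intro v
    refine (card_union_le _ _).trans ?_
    have := card_union_le (univ.filter fun w => G.Adj v w) {v}
    rw [← gDeg_eq_card_filter, hG v, card_singleton] at this
    have h2 := hX v
    rw [gDeg_eq_card_filter] at h2
    omega
  have hall := card_darts_from hG univ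
  have h1 := card_darts_from hG (B a)
  have h2 := card_darts_to hG (B b)
  have h3 := card_pairs_mem_le S
  set A := univ.filter fun p : Fin n × Fin n => p.1 ∈ univ ∧ G.Adj p.1 p.2
  set A1 := univ.filter fun p : Fin n × Fin n => p.1 ∈ B a ∧ G.Adj p.1 p.2
  set A2 := univ.filter fun p : Fin n × Fin n => p.2 ∈ B b ∧ G.Adj p.1 p.2
  set A3 := univ.filter fun p : Fin n × Fin n => s(p.1, p.2) ∈ S
  have hsub : A ⊆ good ∪ (A1 ∪ A2 ∪ A3) := by
    intro p hp
    simp only [A, good, A1, A2, A3, B, mem_union, mem_filter, mem_univ, true_and,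
      mem_singleton] at hp ⊢
    tauto
  have hc := card_le_card hsub
  have c1 := card_union_le good (A1 ∪ A2 ∪ A3)
  have c2 := card_union_le (A1 ∪ A2) A3
  have c3 := card_union_le A1 A2
  have b1 := Nat.mul_le_mul_right d (hB a)
  have b2 := Nat.mul_le_mul_right d (hB b)
  rw [card_univ, Fintype.card_fin] at hall
  have : 1 ≤ D := by omega
  have : D ≤ D * d := Nat.le_mul_of_pos_right _ hd
  have : d ≤ D * d := Nat.le_mul_of_pos_left _ (by omega)
  nlinarith

lemma card_insert_mul_le {d x D : ℕ} {X : SimpleGraph (Fin n)} (hX : ∀ v, gDeg X v ≤ x)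
    {S : Finset (Sym2 (Fin n))} (hS : S.card ≤ 2) (hd : 1 ≤ d) (hD : d + x ≤ D) {a b : Fin n}
    (hab : s(a, b) ∉ S) :
    (regularAvoiding d X (insert s(a, b) S)).card * n ≤
      d * (regularAvoiding d X S).card +
        8 * D * (regularAvoiding d X (insert s(a, b) S)).card := by
  let P := (regularAvoiding d X (insert s(a, b) S)).sigma fun G =>
    univ.filter fun p : Fin n × Fin n => G.Adj p.1 p.2 ∧
      (¬ G.Adj a p.1 ∧ p.1 ≠ a ∧ ¬ X.Adj a p.1) ∧
      (¬ G.Adj b p.2 ∧ p.2 ≠ b ∧ ¬ X.Adj b p.2) ∧ s(p.1, p.2) ∉ S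
  let Q := (regularAvoiding d X S).sigma fun G =>
    (univ.filter fun w => G.Adj a w) ×ˢ (univ.filter fun w => G.Adj b w)
  have hPQ : P.card ≤ Q.card := by
    refine card_le_card_of_injOn (fun t => ⟨t.1 ∆ fourCycle a b t.2.1 t.2.2, t.2⟩) ?_ ?_
    · rintro ⟨G, c, e⟩ ht
      simp only [P, coe_sigma, Set.mem_sigma_iff, mem_coe, mem_regularAvoiding, mem_insert,
        forall_eq_or_imp, SimpleGraph.mem_edgeSet, mem_filter, mem_univ, true_and] at ht
      obtain ⟨⟨hG, hXG, hGab, hGS⟩, hce, ⟨h1, h2, h3⟩, ⟨h4, h5, h6⟩, h7⟩ := ht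
      have hadj := fourCycle_adj (a := a) (b := b) (c := c) (e := e) hGab.ne h2.symm h5.symm hce.ne
      simp only [Q, coe_sigma, Set.mem_sigma_iff, mem_coe, mem_regularAvoiding, mem_product,
        mem_filter, mem_univ, true_and]
      refine ⟨⟨hG.symmDiff_fourCycle h2.symm h5.symm hGab hce h1 h4, ?_, ?_⟩, ?_, ?_⟩
      · rw [disjoint_iff_forall_adj] at hXG ⊢
        intro v w hvw
        have hwv := hvw.symm
        have := hXG v w hvw
        rw [symmDiff_adj, hadj]
        rintro (⟨h, -⟩ | ⟨h, -⟩)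
        · exact this h
        · grind [SimpleGraph.Adj.symm]
      · intro s hs
        have hs' := hGS s hs
        induction s using Sym2.ind with
        | _ u v =>
          rw [SimpleGraph.mem_edgeSet] at hs' ⊢
          rw [symmDiff_adj, hadj]
          refine Or.inl ⟨hs', ?_⟩
          grind [SimpleGraph.Adj.symm, Sym2.eq_swap]
      · rw [symmDiff_adj, hadj]
        exact Or.inr ⟨by simp, h1⟩
      · rw [symmDiff_adj, hadj]
        exact Or.inr ⟨by simp, h4⟩
    · rintro ⟨G, p⟩ - ⟨G', p'⟩ - h
      simp only [Sigma.mk.injEq, heq_eq_eq] at h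
      obtain ⟨h1, rfl⟩ := h
      rw [symmDiff_left_injective _ h1]
  have hQ : Q.card = (regularAvoiding d X S).card * (d * d) := by
    rw [card_sigma, ← smul_eq_mul, ← sum_const]
    refine sum_congr rfl fun G hG => ?_
    rw [card_product, ← gDeg_eq_card_filter, ← gDeg_eq_card_filter,
      (mem_regularAvoiding.1 hG).1, (mem_regularAvoiding.1 hG).1]
  have hP : (regularAvoiding d X (insert s(a, b) S)).card * (n * d) ≤
      P.card + (regularAvoiding d X (insert s(a, b) S)).card * (8 * D * d) := by
    rw [card_sigma, ← smul_eq_mul, ← smul_eq_mul (_ : ℕ) (8 * D * d), ← sum_const, ← sum_const,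
      ← sum_add_distrib]
    exact sum_le_sum fun G hG =>
      card_switchable_ge hX (mem_regularAvoiding.1 hG).1 hS hd hD a b
  refine le_of_mul_le_mul_right ?_ (show 0 < d from hd)
  calc _ = (regularAvoiding d X (insert s(a, b) S)).card * (n * d) := by ring
    _ ≤ _ := hP
    _ ≤ _ := by rw [hQ] at hPQ; nlinarith

lemma card_insert_le {d x D : ℕ} {X : SimpleGraph (Fin n)} (hX : ∀ v, gDeg X v ≤ x)
    {S : Finset (Sym2 (Fin n))} (hS : S.card ≤ 2) (hd : 1 ≤ d) (hD : d + x ≤ D)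
    (hn : 100 * D ≤ n) {a b : Fin n} (hab : s(a, b) ∉ S) :
    ((regularAvoiding d X (insert s(a, b) S)).card : ℝ) ≤
      2 * d / n * (regularAvoiding d X S).card := by
  have h := card_insert_mul_le hX hS hd hD hab
  have hn0 : (0 : ℝ) < n := by
    have : 0 < n := by omega
    exact_mod_cast this
  have hn' : (100 * D : ℝ) ≤ n := by exact_mod_cast hn
  have h' : ((regularAvoiding d X (insert s(a, b) S)).card : ℝ) * n ≤
      d * (regularAvoiding d X S).card +
        8 * D * (regularAvoiding d X (insert s(a, b) S)).card := by exact_mod_cast h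
  rw [div_mul_eq_mul_div, le_div_iff₀ hn0]
  have : (0 : ℝ) ≤ (regularAvoiding d X (insert s(a, b) S)).card := by positivity
  nlinarith

/-- The `d`-regular graphs disjoint from `X` that contain `ac` and `be` but not `ab`. -/
noncomputable def regularCherry (d : ℕ) (X : SimpleGraph (Fin n)) (a b : Fin n)
    (p : Fin n × Fin n) : Finset (SimpleGraph (Fin n)) :=
  (regularAvoiding d X ∅).filter fun G => ¬ G.Adj a b ∧ G.Adj a p.1 ∧ G.Adj b p.2

lemma card_regularCherry_le {d x D : ℕ} {X : SimpleGraph (Fin n)} (hX : ∀ v, gDeg X v ≤ x)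
    (hd : 1 ≤ d) (hD : d + x ≤ D) (hn : 100 * D ≤ n) {a b : Fin n} (hab : a ≠ b)
    (p : Fin n × Fin n) :
    ((regularCherry d X a b p).card : ℝ) ≤
      (2 * d / n) ^ 2 * (regularAvoiding d X ∅).card := by
  obtain ⟨c, e⟩ := p
  by_cases hce : s(a, c) = s(b, e)
  · have : regularCherry d X a b (c, e) = ∅ := by
      refine filter_eq_empty_iff.2 fun G _ ⟨h1, h2, h3⟩ => ?_
      grind [Sym2.eq_iff]
    rw [this, card_empty, Nat.cast_zero]
    positivity
  · have h1 := card_insert_le hX (S := {s(b, e)}) (by simp) hd hD hn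
      (a := a) (b := c) (by simpa using hce)
    have h2 := card_insert_le hX (S := ∅) (by simp) hd hD hn (a := b) (b := e) (by simp)
    have h3 : regularCherry d X a b (c, e) ⊆
        regularAvoiding d X (insert s(a, c) {s(b, e)}) := by
      intro G hG
      simp only [regularCherry, mem_filter, mem_regularAvoiding] at hG ⊢
      simp only [mem_insert, mem_singleton, forall_eq_or_imp, forall_eq, SimpleGraph.mem_edgeSet]
      tauto
    have h4 : ((regularCherry d X a b (c, e)).card : ℝ) ≤ _ :=
      (Nat.cast_le.2 (card_le_card h3)).trans h1
    refine h4.trans ?_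
    rw [sq, mul_assoc]
    exact mul_le_mul_of_nonneg_left h2 (by positivity)

lemma card_regularCherry_filter_adj_le {d x D : ℕ} {X : SimpleGraph (Fin n)}
    (hX : ∀ v, gDeg X v ≤ x) (hd : 1 ≤ d) (hD : d + x ≤ D) (hn : 100 * D ≤ n) {a b : Fin n}
    (hab : a ≠ b) (p : Fin n × Fin n) :
    (((regularCherry d X a b p).filter fun G => G.Adj p.1 p.2).card : ℝ) ≤
      (2 * d / n) ^ 3 * (regularAvoiding d X ∅).card := by
  obtain ⟨c, e⟩ := p
  by_cases hce : s(a, c) = s(b, e) ∨ s(c, e) = s(a, c) ∨ s(c, e) = s(b, e)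
  · have : ((regularCherry d X a b (c, e)).filter fun G => G.Adj c e) = ∅ := by
      refine filter_eq_empty_iff.2 fun G hG h4 => ?_
      obtain ⟨h1, h2, h3⟩ := (mem_filter.1 hG).2
      grind [Sym2.eq_iff, SimpleGraph.Adj.symm, SimpleGraph.Adj.ne]
    rw [this, card_empty, Nat.cast_zero]
    positivity
  · push Not at hce
    have h0 := card_insert_le hX (S := {s(a, c), s(b, e)}) card_le_two hd hD hn
      (a := c) (b := e) (by simpa using hce.2)
    have h1 := card_insert_le hX (S := {s(b, e)}) (by simp) hd hD hn
      (a := a) (b := c) (by simpa using hce.1)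
    have h2 := card_insert_le hX (S := ∅) (by simp) hd hD hn (a := b) (b := e) (by simp)
    have h3 : ((regularCherry d X a b (c, e)).filter fun G => G.Adj c e) ⊆
        regularAvoiding d X (insert s(c, e) {s(a, c), s(b, e)}) := by
      intro G hG
      simp only [regularCherry, mem_filter, mem_regularAvoiding] at hG ⊢
      simp only [mem_insert, mem_singleton, forall_eq_or_imp, forall_eq, SimpleGraph.mem_edgeSet]
      tauto
    have h4 : (((regularCherry d X a b (c, e)).filter fun G => G.Adj c e).card : ℝ) ≤ _ :=
      (Nat.cast_le.2 (card_le_card h3)).trans h0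
    refine h4.trans ?_
    have hp : (0 : ℝ) ≤ 2 * d / n := by positivity
    calc _ ≤ 2 * (d : ℝ) / n * (2 * d / n * (2 * d / n * (regularAvoiding d X ∅).card)) :=
          mul_le_mul_of_nonneg_left (h1.trans (mul_le_mul_of_nonneg_left h2 hp)) hp
      _ = _ := by ring

lemma card_regularCherry_switchable_le {d : ℕ} {X : SimpleGraph (Fin n)} {a b : Fin n}
    (hab : a ≠ b) (hXab : ¬ X.Adj a b) {p : Fin n × Fin n} (hp : p.1 ≠ p.2)
    (hXp : ¬ X.Adj p.1 p.2) :
    ((regularCherry d X a b p).filter fun G => ¬ G.Adj p.1 p.2).card ≤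
      ((regularAvoiding d X {s(a, b)}).filter fun G => G.Adj p.1 p.2).card := by
  obtain ⟨c, e⟩ := p
  refine card_le_card_of_injOn (fun G => G ∆ fourCycle a c b e) ?_
    (symmDiff_left_injective _).injOn
  intro G hG
  simp only [regularCherry, coe_filter, Set.mem_ofPred_eq, mem_filter, mem_regularAvoiding] at hG ⊢
  obtain ⟨⟨⟨hG, hXG, -⟩, h1, h2, h3⟩, h4⟩ := hG
  have hadj := fourCycle_adj (a := a) (b := c) (c := b) (e := e) h2.ne hab hp h3.ne
  refine ⟨⟨hG.symmDiff_fourCycle hab hp h2 h3 h1 h4, ?_, ?_⟩, ?_⟩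
  · rw [disjoint_iff_forall_adj] at hXG ⊢
    intro v w hvw
    have hwv := hvw.symm
    have := hXG v w hvw
    rw [symmDiff_adj, hadj]
    rintro (⟨h, -⟩ | ⟨h, -⟩)
    · exact this h
    · grind [SimpleGraph.Adj.symm]
  · simp only [mem_singleton, forall_eq, SimpleGraph.mem_edgeSet]
    rw [symmDiff_adj, hadj]
    exact Or.inr ⟨by simp, h1⟩
  · rw [symmDiff_adj, hadj]
    exact Or.inr ⟨by simp, h4⟩

lemma sum_card_regularCherry (d : ℕ) (X : SimpleGraph (Fin n)) (a b : Fin n) :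
    ∑ p, (regularCherry d X a b p).card =
      ((regularAvoiding d X ∅).filter fun G => ¬ G.Adj a b).card * (d * d) := by
  have h := sum_card_bipartiteAbove_eq_sum_card_bipartiteBelow
    (s := (regularAvoiding d X ∅).filter fun G => ¬ G.Adj a b)
    (t := (univ : Finset (Fin n × Fin n)))
    (fun G p => G.Adj a p.1 ∧ G.Adj b p.2)
  rw [← smul_eq_mul, ← sum_const]
  trans ∑ p : Fin n × Fin n, (bipartiteBelow (fun G p => G.Adj a p.1 ∧ G.Adj b p.2)
    ((regularAvoiding d X ∅).filter fun G => ¬ G.Adj a b) p).card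
  · refine sum_congr rfl fun p _ => ?_
    rw [bipartiteBelow, filter_filter, regularCherry]
  rw [← h]
  refine sum_congr rfl fun G hG => ?_
  have hG := (mem_regularAvoiding.1 (mem_filter.1 hG).1).1
  have : bipartiteAbove (fun (G : SimpleGraph (Fin n)) p => G.Adj a p.1 ∧ G.Adj b p.2)
      (univ : Finset (Fin n × Fin n)) G =
      (univ.filter fun w => G.Adj a w) ×ˢ (univ.filter fun w => G.Adj b w) := by
    ext p
    simp [bipartiteAbove]
  rw [this, card_product, ← gDeg_eq_card_filter, ← gDeg_eq_card_filter, hG, hG]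

lemma sum_card_filter_adj (d : ℕ) (X : SimpleGraph (Fin n)) (S : Finset (Sym2 (Fin n))) :
    ∑ p : Fin n × Fin n, ((regularAvoiding d X S).filter fun G => G.Adj p.1 p.2).card =
      (regularAvoiding d X S).card * (n * d) := by
  have h := sum_card_bipartiteAbove_eq_sum_card_bipartiteBelow
    (s := regularAvoiding d X S) (t := (univ : Finset (Fin n × Fin n)))
    (fun G p => G.Adj p.1 p.2)
  rw [← smul_eq_mul, ← sum_const]
  refine h.symm.trans (sum_congr rfl fun G hG => ?_)
  have := card_darts_from (mem_regularAvoiding.1 hG).1 univ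
  simpa [bipartiteAbove] using this

lemma card_darts_le {X : SimpleGraph (Fin n)} {x : ℕ} (hX : ∀ v, gDeg X v ≤ x) :
    (univ.filter fun p : Fin n × Fin n => X.Adj p.1 p.2).card ≤ n * x := by
  rw [card_filter, Fintype.sum_prod_type]
  calc _ ≤ ∑ _v : Fin n, x := sum_le_sum fun v _ => by
        rw [← card_filter, ← gDeg_eq_card_filter]
        exact hX v
    _ = _ := by simp

lemma sq_mul_card_le {d x D : ℕ} {X : SimpleGraph (Fin n)} (hX : ∀ v, gDeg X v ≤ x)
    (hd : 1 ≤ d) (hD : d + x ≤ D) (hn : 100 * D ≤ n) {a b : Fin n} (hab : a ≠ b)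
    (hXab : ¬ X.Adj a b) :
    (((regularAvoiding d X ∅).filter fun G => ¬ G.Adj a b).card * (d * d) : ℝ) ≤
      (regularAvoiding d X {s(a, b)}).card * (n * d) +
      (n * (2 * d / n) ^ 2 + n * x * (2 * d / n) ^ 2 + n * n * (2 * d / n) ^ 3) *
        (regularAvoiding d X ∅).card := by
  set r : ℝ := ((regularAvoiding d X ∅).card : ℝ)
  set q : ℝ := 2 * d / n
  have hr : 0 ≤ r := by positivity
  have hq : 0 ≤ q := by positivity
  have key : ∀ p : Fin n × Fin n, ((regularCherry d X a b p).card : ℝ) ≤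
      ((regularAvoiding d X {s(a, b)}).filter fun G => G.Adj p.1 p.2).card +
      (if p.1 = p.2 then q ^ 2 * r else 0) + (if X.Adj p.1 p.2 then q ^ 2 * r else 0) +
      q ^ 3 * r := by
    intro p
    have h2 := card_regularCherry_le hX hd hD hn hab p
    have h3 := card_regularCherry_filter_adj_le hX hd hD hn hab p
    have e2 : 0 ≤ q ^ 2 * r := by positivity
    have e3 : 0 ≤ q ^ 3 * r := by positivity
    have e4 : (0 : ℝ) ≤
      ((regularAvoiding d X {s(a, b)}).filter fun G => G.Adj p.1 p.2).card := by positivity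
    by_cases h4 : p.1 = p.2
    · rw [if_pos h4]
      split_ifs
      all_goals linarith
    by_cases h5 : X.Adj p.1 p.2
    · rw [if_pos h5]
      split_ifs
      linarith
    rw [if_neg h4, if_neg h5]
    have h6 : (_ : ℝ) ≤ _ := Nat.cast_le.2
      (card_regularCherry_switchable_le (d := d) hab hXab h4 h5)
    have h7 := card_filter_add_card_filter_not (s := regularCherry d X a b p)
      (fun G => G.Adj p.1 p.2)
    rw [← h7]
    push_cast
    linarith
  have hsum := sum_le_sum fun p (_ : p ∈ univ) => key p
  simp only [sum_add_distrib, ← Nat.cast_sum, sum_card_regularCherry, sum_card_filter_adj,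
    ← sum_filter, sum_const, nsmul_eq_mul] at hsum
  have hdiag : (univ.filter fun p : Fin n × Fin n => p.1 = p.2).card = n := by
    rw [card_filter, Fintype.sum_prod_type]
    simp
  have hdart : ((univ.filter fun p : Fin n × Fin n => X.Adj p.1 p.2).card : ℝ) ≤ n * x := by
    exact_mod_cast card_darts_le hX
  rw [hdiag] at hsum
  simp only [card_univ, Fintype.card_prod, Fintype.card_fin] at hsum
  push_cast at hsum
  have := mul_le_mul_of_nonneg_right hdart (show 0 ≤ q ^ 2 * r by positivity)
  linarith

lemma card_edge_bounds {d x D : ℕ} {X : SimpleGraph (Fin n)} (hX : ∀ v, gDeg X v ≤ x)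
    (hd : 1 ≤ d) (hD : d + x ≤ D) (hn : 100 * D ≤ n) {a b : Fin n} (hab : a ≠ b)
    (hXab : ¬ X.Adj a b) :
    (d / n - 17 * (d * D / n ^ 2)) * (regularAvoiding d X ∅).card ≤
      ((regularAvoiding d X {s(a, b)}).card : ℝ) ∧
    ((regularAvoiding d X {s(a, b)}).card : ℝ) ≤
      (d / n + 17 * (d * D / n ^ 2)) * (regularAvoiding d X ∅).card := by
  have hup := card_insert_mul_le hX (S := ∅) (by simp) hd hD (a := a) (b := b) (by simp)
  have hlow := sq_mul_card_le hX hd hD hn hab hXab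
  have hsplit := card_filter_add_card_filter_not (s := regularAvoiding d X ∅)
    (fun G => G.Adj a b)
  have hfil : (regularAvoiding d X ∅).filter (fun G => G.Adj a b) =
      regularAvoiding d X {s(a, b)} := by
    ext G
    simp [mem_regularAvoiding, and_assoc]
  rw [hfil] at hsplit
  have hup' : ((regularAvoiding d X {s(a, b)}).card : ℝ) * n ≤
      d * (regularAvoiding d X ∅).card + 8 * D * (regularAvoiding d X {s(a, b)}).card := by
    exact_mod_cast hup
  have hsplit' : ((regularAvoiding d X {s(a, b)}).card : ℝ) +
      ((regularAvoiding d X ∅).filter fun G => ¬ G.Adj a b).card =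
      (regularAvoiding d X ∅).card := by exact_mod_cast hsplit
  have hn0 : (0 : ℝ) < n := by
    have : 0 < n := by omega
    exact_mod_cast this
  have hn' : (100 * D : ℝ) ≤ n := by exact_mod_cast hn
  have hd' : (1 : ℝ) ≤ d := by exact_mod_cast hd
  have hD' : (d + x : ℝ) ≤ D := by exact_mod_cast hD
  have hx : (0 : ℝ) ≤ x := by positivity
  generalize ((regularAvoiding d X {s(a, b)}).card : ℝ) = t at *
  generalize (((regularAvoiding d X ∅).filter fun G => ¬ G.Adj a b).card : ℝ) = u at *
  have hr : (0 : ℝ) ≤ (regularAvoiding d X ∅).card := by positivity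
  generalize ((regularAvoiding d X ∅).card : ℝ) = r at *
  generalize (d : ℝ) = d at *
  generalize (D : ℝ) = D at *
  generalize (x : ℝ) = x at *
  generalize (n : ℝ) = m at *
  obtain rfl : u = r - t := by linarith
  clear hsplit' hsplit hup hX hd hD hn hXab hab hfil
  have hD0 : 0 ≤ D := by linarith
  constructor
  · have e1 : (m * (2 * d / m) ^ 2 + m * x * (2 * d / m) ^ 2 + m * m * (2 * d / m) ^ 3) =
        (4 * d + 4 * x * d + 8 * d ^ 2) / m * d := by
      field_simp
      ring
    have e2 : (4 * d + 4 * x * d + 8 * d ^ 2) / m ≤ 12 * d * D / m := by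
      gcongr
      nlinarith
    have e3 : (r - t) * d ≤ t * m + 12 * d * D / m * r := by
      refine le_of_mul_le_mul_right (a := d) ?_ (by linarith)
      have := mul_le_mul_of_nonneg_right e2 (show 0 ≤ d * r by positivity)
      rw [e1] at hlow
      linarith
    have e4 : d * r * (m - 12 * D) ≤ t * m * (m + d) := by
      have h := mul_le_mul_of_nonneg_right e3 hn0.le
      have : 12 * d * D / m * r * m = 12 * d * D * r := by field_simp
      rw [add_mul, this] at h
      linarith
    have e5 : d * r * ((m - 17 * D) * (m + d)) ≤ d * r * (m * (m - 12 * D)) := by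
      refine mul_le_mul_of_nonneg_left ?_ (by positivity)
      nlinarith
    have e6 : d * r * (m - 17 * D) ≤ t * m ^ 2 := by
      refine le_of_mul_le_mul_right (a := m + d) ?_ (by linarith)
      have := mul_le_mul_of_nonneg_right e4 hn0.le
      linarith
    have e7 : (d / m - 17 * (d * D / m ^ 2)) * r = d * r * (m - 17 * D) / m ^ 2 := by
      field_simp
    rw [e7, div_le_iff₀ (by positivity)]
    exact e6
  · have e1 : t * m ^ 2 ≤ d * r * (m + 17 * D) := by
      refine le_of_mul_le_mul_right (a := m - 8 * D) ?_ (by linarith)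
      have h1 : t * (m - 8 * D) ≤ d * r := by linarith
      have h2 := mul_le_mul_of_nonneg_right h1 (sq_nonneg m)
      have h3 : d * r * m ^ 2 ≤ d * r * ((m + 17 * D) * (m - 8 * D)) := by
        refine mul_le_mul_of_nonneg_left ?_ (by positivity)
        nlinarith
      linarith
    have e2 : (d / m + 17 * (d * D / m ^ 2)) * r = d * r * (m + 17 * D) / m ^ 2 := by
      field_simp
    rw [e2, le_div_iff₀ (by positivity)]
    exact e1

lemma gDeg_le_of_le {X Y : SimpleGraph (Fin n)} (h : X ≤ Y) (v : Fin n) : gDeg X v ≤ gDeg Y v := by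
  rw [gDeg_eq_card_filter, gDeg_eq_card_filter]
  exact card_le_card fun w hw => by
    simp only [mem_filter, mem_univ, true_and] at hw ⊢
    exact h hw

lemma card_regularAvoiding_bounds {d x D : ℕ} (hd : 1 ≤ d) (hD : d + x ≤ D)
    (hn : 100 * D ≤ n) (m : ℕ) (X : SimpleGraph (Fin n)) (hX : ∀ v, gDeg X v ≤ x)
    (hm : X.edgeFinset.card = m) :
    (1 - d / n - 17 * (d * D / n ^ 2)) ^ m * (regularAvoiding d (⊥ : SimpleGraph (Fin n)) ∅).card ≤
      ((regularAvoiding d X ∅).card : ℝ) ∧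
    ((regularAvoiding d X ∅).card : ℝ) ≤
      (1 - d / n + 17 * (d * D / n ^ 2)) ^ m *
        (regularAvoiding d (⊥ : SimpleGraph (Fin n)) ∅).card := by
  have hn0 : (0 : ℝ) < n := by
    have : 0 < n := by omega
    exact_mod_cast this
  have hn' : (100 * D : ℝ) ≤ n := by exact_mod_cast hn
  have hdD : (d : ℝ) ≤ D := by
    have : d ≤ D := by omega
    exact_mod_cast this
  have q1 : (d : ℝ) / n ≤ 1 / 100 := by
    rw [div_le_iff₀ hn0]
    linarith
  have q2 : (d * D : ℝ) / n ^ 2 ≤ 1 / 10000 := by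
    rw [div_le_iff₀ (by positivity)]
    have : (0 : ℝ) ≤ d := by positivity
    nlinarith
  have q3 : (0 : ℝ) ≤ d * D / n ^ 2 := by positivity
  induction m generalizing X with
  | zero =>
    rw [card_eq_zero, SimpleGraph.edgeFinset_eq_empty] at hm
    subst hm
    simp
  | succ m ih =>
    obtain ⟨s, hs⟩ : X.edgeFinset.Nonempty := card_pos.1 (by omega)
    induction s using Sym2.ind with
    | _ a b =>
    rw [SimpleGraph.mem_edgeFinset, SimpleGraph.mem_edgeSet] at hs
    set Y := X.deleteEdges {s(a, b)} with hY
    have hYX : Y ≤ X := SimpleGraph.deleteEdges_le _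
    have hYm : Y.edgeFinset.card = m := by
      have h1 : Y.edgeFinset = X.edgeFinset.erase s(a, b) := by
        ext e
        simp [hY, SimpleGraph.edgeSet_deleteEdges, and_comm]
      rw [h1, card_erase_of_mem (by simpa using hs), hm]
      rfl
    have hYdeg : ∀ v, gDeg Y v ≤ x := fun v => (gDeg_le_of_le hYX v).trans (hX v)
    obtain ⟨l, u⟩ := ih Y hYdeg (by convert hYm)
    have hYab : ¬ Y.Adj a b := by simp [hY]
    obtain ⟨l', u'⟩ := card_edge_bounds hYdeg hd hD hn hs.ne hYab
    have hXY : X = Y ⊔ SimpleGraph.edge a b := by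
      ext v w
      simp only [hY, SimpleGraph.sup_adj, SimpleGraph.deleteEdges_adj, Set.mem_singleton_iff,
        SimpleGraph.edge_adj, Sym2.eq_iff]
      have := hs.ne
      have := hs.symm
      grind
    have hsplit := card_filter_add_card_filter_not (s := regularAvoiding d Y ∅)
      (fun G => G.Adj a b)
    have h1 : (regularAvoiding d Y ∅).filter (fun G => G.Adj a b) =
        regularAvoiding d Y {s(a, b)} := by
      ext G
      simp [mem_regularAvoiding, and_assoc]
    have h2 : (regularAvoiding d Y ∅).filter (fun G => ¬ G.Adj a b) =
        regularAvoiding d X ∅ := by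
      ext G
      simp only [mem_filter, mem_regularAvoiding, hXY, disjoint_sup_left,
        disjoint_iff_forall_adj (X := SimpleGraph.edge a b), SimpleGraph.edge_adj]
      have := hs.ne
      have h3 : G.Adj b a ↔ G.Adj a b := G.adj_comm b a
      grind
    rw [h1, h2] at hsplit
    have hsplit' : ((regularAvoiding d Y {s(a, b)}).card : ℝ) + (regularAvoiding d X ∅).card =
      (regularAvoiding d Y ∅).card := by exact_mod_cast hsplit
    constructor
    · have := mul_le_mul_of_nonneg_left l
        (show (0 : ℝ) ≤ 1 - d / n - 17 * (d * D / n ^ 2) by linarith)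
      rw [pow_succ']
      linarith
    · have := mul_le_mul_of_nonneg_left u
        (show (0 : ℝ) ≤ 1 - d / n + 17 * (d * D / n ^ 2) by linarith)
      rw [pow_succ']
      linarith

lemma IsRegularGraph.two_mul_card_edgeFinset {X : SimpleGraph (Fin n)} {x : ℕ}
    (hX : IsRegularGraph X x) : 2 * X.edgeFinset.card = n * x := by
  rw [← X.sum_degrees_eq_twice_card_edges]
  calc _ = ∑ _v : Fin n, x := sum_congr rfl fun v _ => by
        rw [← hX v, gDeg_eq_card_filter, ← SimpleGraph.card_neighborFinset_eq_degree,
          SimpleGraph.neighborFinset_eq_filter]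
    _ = _ := by simp

lemma card_regularAvoiding_le_exp_mul {d x D : ℕ} (hd : 1 ≤ d) (hD : d + x ≤ D)
    (hn : 100 * D ≤ n) {X Y : SimpleGraph (Fin n)} (hX : IsRegularGraph X x)
    (hY : IsRegularGraph Y x) :
    ((regularAvoiding d X ∅).card : ℝ) ≤
      Real.exp (34 * D ^ 2 * d / n) * (regularAvoiding d Y ∅).card := by
  have hXe := hX.two_mul_card_edgeFinset
  have hYe := hY.two_mul_card_edgeFinset
  set m := X.edgeFinset.card with hm
  have u := (card_regularAvoiding_bounds hd hD hn m X (fun v => (hX v).le) hm.symm).2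
  have l := (card_regularAvoiding_bounds hd hD hn m Y (fun v => (hY v).le) (by omega)).1
  have hn0 : (0 : ℝ) < n := by
    have : 0 < n := by omega
    exact_mod_cast this
  have hn' : (100 * D : ℝ) ≤ n := by exact_mod_cast hn
  have hdD : (d : ℝ) ≤ D := by
    have : d ≤ D := by omega
    exact_mod_cast this
  have hxD : (x : ℝ) ≤ D := by
    have : x ≤ D := by omega
    exact_mod_cast this
  have hm' : (2 * m : ℝ) = n * x := by exact_mod_cast hXe
  have q1 : (d : ℝ) / n ≤ 1 / 100 := by
    rw [div_le_iff₀ hn0]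
    linarith
  have q2 : (d * D : ℝ) / n ^ 2 ≤ 1 / 10000 := by
    rw [div_le_iff₀ (by positivity)]
    have : (0 : ℝ) ≤ d := by positivity
    nlinarith
  have q3 : (0 : ℝ) ≤ d * D / n ^ 2 := by positivity
  have hexp : 4 * (17 * (d * D / n ^ 2)) * m ≤ 34 * (D : ℝ) ^ 2 * d / n := by
    have : 4 * (17 * (d * D / n ^ 2)) * m = 34 * (D : ℝ) * d * x / n := by
      have : (m : ℝ) = n * x / 2 := by linarith
      rw [this]
      field_simp
      ring
    rw [this]
    have : 34 * (D : ℝ) * d * x ≤ 34 * D ^ 2 * d := by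
      nlinarith [show (0 : ℝ) ≤ D * d by positivity]
    gcongr
  set ε : ℝ := 17 * (d * D / n ^ 2)
  set q : ℝ := (d : ℝ) / n
  set r : ℝ := ((regularAvoiding d (⊥ : SimpleGraph (Fin n)) ∅).card : ℝ)
  have hε : 0 ≤ ε := by positivity
  have hstep : 1 - q + ε ≤ (1 - q - ε) * (1 + 4 * ε) := by nlinarith
  have hq0 : 0 ≤ q := by positivity
  have hlow : 0 ≤ 1 - q - ε := by linarith
  calc _ ≤ (1 - q + ε) ^ m * r := u
    _ ≤ ((1 - q - ε) * (1 + 4 * ε)) ^ m * r := by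
        gcongr
        linarith
    _ = (1 + 4 * ε) ^ m * ((1 - q - ε) ^ m * r) := by
        rw [mul_pow]
        ring
    _ ≤ Real.exp (4 * ε) ^ m * ((1 - q - ε) ^ m * r) := by
        gcongr
        linarith [Real.add_one_le_exp (4 * ε)]
    _ ≤ Real.exp (34 * D ^ 2 * d / n) * (regularAvoiding d Y ∅).card := by
        rw [← Real.exp_nat_mul, mul_comm (m : ℝ)]
        gcongr

lemma IsRegularGraph.sup {X Y : SimpleGraph (Fin n)} {x y : ℕ} (hX : IsRegularGraph X x)
    (hY : IsRegularGraph Y y) (h : Disjoint X Y) : IsRegularGraph (X ⊔ Y) (x + y) := by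
  intro v
  rw [← hX v, ← hY v]
  simp only [gDeg_eq_card_filter, SimpleGraph.sup_adj]
  rw [filter_or, card_union_of_disjoint]
  rw [disjoint_iff_forall_adj] at h
  exact disjoint_filter.2 fun w _ => h v w

/-- The tuples of pairwise edge-disjoint graphs, the `i`-th of which is `d i`-regular, that are
all edge-disjoint from `H`. -/
noncomputable def regularTuples {m : ℕ} (d : Fin m → ℕ) (H : SimpleGraph (Fin n)) :
    Finset (Fin m → SimpleGraph (Fin n)) :=
  univ.filter fun f => (∀ i j, i ≠ j → Disjoint (f i) (f j)) ∧ (∀ i, Disjoint H (f i)) ∧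
    ∀ i, IsRegularGraph (f i) (d i)

lemma card_regularTuples_succ {m : ℕ} (d : Fin (m + 1) → ℕ) (H : SimpleGraph (Fin n)) :
    (regularTuples d H).card = ∑ G ∈ regularAvoiding (d 0) H ∅,
      (regularTuples (fun i => d (Fin.succ i)) (H ⊔ G)).card := by
  rw [← card_sigma]
  refine card_bij' (fun f _ => ⟨f 0, fun i => f i.succ⟩) (fun t _ => Fin.cons t.1 t.2)
    ?_ ?_ ?_ ?_
  · intro f hf
    simp only [regularTuples, mem_filter, mem_univ, true_and, mem_sigma, mem_regularAvoiding,
      disjoint_sup_left] at hf ⊢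
    obtain ⟨h1, h2, h3⟩ := hf
    exact ⟨⟨h3 0, h2 0, by simp⟩, fun i j hij => h1 _ _ (by simpa using hij),
      fun i => ⟨h2 _, h1 _ _ (Fin.succ_ne_zero i).symm⟩, fun i => h3 _⟩
  · rintro ⟨G, f⟩ hf
    simp only [regularTuples, mem_filter, mem_univ, true_and, mem_sigma, mem_regularAvoiding,
      disjoint_sup_left] at hf ⊢
    obtain ⟨⟨h1, h2, -⟩, h3, h4, h5⟩ := hf
    refine ⟨fun i j hij => ?_, fun i => ?_, fun i => ?_⟩
    · induction i using Fin.cases <;> induction j using Fin.cases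
      · exact absurd rfl hij
      · simpa using (h4 _).2
      · simpa using (h4 _).2.symm
      · simpa using h3 _ _ (by simpa using hij)
    · induction i using Fin.cases
      · simpa using h2
      · simpa using (h4 _).1
    · induction i using Fin.cases
      · simpa using h1
      · simpa using h5 _
  · intro f _
    exact Fin.cons_self_tail f
  · rintro ⟨G, f⟩ _
    simp

lemma sum_le_mul_mul_sum {ι : Type*} {S T : Finset ι} {f g : ι → ℝ} {A B : ℝ} (hB : 0 ≤ B)
    (hg : ∀ j ∈ T, 0 ≤ g j) (hA : (S.card : ℝ) ≤ A * T.card)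
    (h : ∀ i ∈ S, ∀ j ∈ T, f i ≤ B * g j) : ∑ i ∈ S, f i ≤ A * B * ∑ j ∈ T, g j := by
  rcases T.eq_empty_or_nonempty with rfl | h0
  · have : S = ∅ := by
      rw [card_empty, Nat.cast_zero, mul_zero] at hA
      exact card_eq_zero.1 (by exact_mod_cast le_antisymm hA (Nat.cast_nonneg _))
    simp [this]
  · have hc : (0 : ℝ) < T.card := by exact_mod_cast card_pos.2 h0
    refine le_of_mul_le_mul_left ?_ hc
    have hg' : 0 ≤ ∑ j ∈ T, g j := sum_nonneg hg
    calc (T.card : ℝ) * ∑ i ∈ S, f i = ∑ i ∈ S, ∑ _j ∈ T, f i := by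
          rw [mul_sum]
          exact sum_congr rfl fun i _ => by rw [sum_const, nsmul_eq_mul]
      _ ≤ ∑ _i ∈ S, ∑ j ∈ T, B * g j :=
          sum_le_sum fun i hi => sum_le_sum fun j hj => h i hi j hj
      _ = S.card * (B * ∑ j ∈ T, g j) := by rw [sum_const, nsmul_eq_mul, ← mul_sum]
      _ ≤ (A * T.card) * (B * ∑ j ∈ T, g j) := by gcongr
      _ = _ := by ring

lemma card_regularTuples_le {D m : ℕ} (hn : 100 * D ≤ n) (d : Fin m → ℕ) (hd : ∀ i, 1 ≤ d i)
    (x : ℕ) (hD : x + ∑ i, d i ≤ D) (X Y : SimpleGraph (Fin n)) (hX : IsRegularGraph X x)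
    (hY : IsRegularGraph Y x) :
    ((regularTuples d X).card : ℝ) ≤
      Real.exp (34 * D ^ 2 * (∑ i, d i : ℕ) / n) * (regularTuples d Y).card := by
  induction m generalizing x X Y with
  | zero =>
    simp [regularTuples]
  | succ m ih =>
    rw [Fin.sum_univ_succ] at hD
    have hA := card_regularAvoiding_le_exp_mul (hd 0) (D := D) (x := x) (by omega) hn hX hY
    rw [card_regularTuples_succ, card_regularTuples_succ, Fin.sum_univ_succ]
    push_cast
    have hexp : Real.exp (34 * D ^ 2 * (d 0 + ∑ i : Fin m, (d i.succ : ℝ)) / n) =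
        Real.exp (34 * D ^ 2 * d 0 / n) *
          Real.exp (34 * D ^ 2 * (∑ i : Fin m, d i.succ : ℕ) / n) := by
      rw [← Real.exp_add]
      push_cast
      congr 1
      ring
    rw [hexp]
    refine sum_le_mul_mul_sum (Real.exp_pos _).le (fun _ _ => Nat.cast_nonneg _) hA
      fun G hG G' hG' => ?_
    rw [mem_regularAvoiding] at hG hG'
    exact ih (fun i => d i.succ) (fun i => hd _) (x + d 0) (by omega) (X ⊔ G) (Y ⊔ G')
      (hX.sup hG.1 hG.2.1) (hY.sup hG'.1 hG'.2.1)

end Switching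

section Contiguity

open Finset
open scoped Classical

lemma IsProbC.sum_eq_one {α : Type*} [Fintype α] {p : α → ℝ} (hp : IsProbC p) :
    ∑ x, p x = 1 := by
  rw [← hp.2, tsum_fintype]

lemma probOf_eq_sum {α : Type*} [Fintype α] (p : α → ℝ) (A : Set α) :
    probOf p A = ∑ x, if x ∈ A then p x else 0 := by
  rw [probOf, _root_.tsum_subtype, tsum_fintype]
  rfl

lemma IsProbC.sum_mul_mul_sum_mul_le {α : Type*} [Fintype α] {p g Z : α → ℝ} {C : ℝ}
    (hp : IsProbC p) (hg : ∀ x, 0 ≤ g x)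
    (hZ : ∀ x y, p x ≠ 0 → p y ≠ 0 → Z x ≤ C * Z y) :
    (∑ x, p x * g x) * ∑ x, p x * Z x ≤ C * ∑ x, p x * (g x * Z x) := by
  calc (∑ x, p x * g x) * ∑ x, p x * Z x = ∑ x, ∑ y, p x * g x * (p y * Z y) := sum_mul_sum ..
    _ ≤ ∑ x, ∑ y, p y * (C * (p x * (g x * Z x))) := by
        refine sum_le_sum fun x _ => sum_le_sum fun y _ => ?_
        by_cases hx : p x = 0
        · simp [hx]
        by_cases hy : p y = 0
        · simp [hy]
        have := mul_le_mul_of_nonneg_left (hZ y x hy hx)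
          (mul_nonneg (mul_nonneg (hp.1 x) (hg x)) (hp.1 y))
        linarith
    _ = C * ∑ x, p x * (g x * Z x) := by
        simp_rw [← sum_mul, hp.sum_eq_one, one_mul, mul_sum]

lemma IsProbC.sum_mul_mul_le {α : Type*} [Fintype α] {p g Z : α → ℝ} {C : ℝ}
    (hp : IsProbC p) (hg : ∀ x, 0 ≤ g x)
    (hZ : ∀ x y, p x ≠ 0 → p y ≠ 0 → Z x ≤ C * Z y) :
    ∑ x, p x * (g x * Z x) ≤ C * ((∑ x, p x * g x) * ∑ x, p x * Z x) := by
  calc ∑ x, p x * (g x * Z x) = ∑ x, ∑ y, p y * (p x * (g x * Z x)) := by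
        simp_rw [← sum_mul, hp.sum_eq_one, one_mul]
    _ ≤ ∑ x, ∑ y, C * (p x * g x * (p y * Z y)) := by
        refine sum_le_sum fun x _ => sum_le_sum fun y _ => ?_
        by_cases hx : p x = 0
        · simp [hx]
        by_cases hy : p y = 0
        · simp [hy]
        have := mul_le_mul_of_nonneg_left (hZ x y hx hy)
          (mul_nonneg (mul_nonneg (hp.1 x) (hg x)) (hp.1 y))
        linarith
    _ = C * ((∑ x, p x * g x) * ∑ x, p x * Z x) := by
        rw [sum_mul_sum, mul_sum]
        simp_rw [mul_sum]

variable {Ω : ℕ → Type*} [∀ n, Fintype (Ω n)] {p q : (n : ℕ) → Ω n → ℝ}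

lemma Contiguous.tendsto_sum_mul_zero (h : Contiguous p q) (hp : ∀ n, IsProbC (p n))
    (hq : ∀ n, IsProbC (q n)) {g : (n : ℕ) → Ω n → ℝ} (hg0 : ∀ n x, 0 ≤ g n x)
    (hg1 : ∀ n x, g n x ≤ 1) (hpg : Tendsto (fun n => ∑ x, p n x * g n x) atTop (𝓝 0)) :
    Tendsto (fun n => ∑ x, q n x * g n x) atTop (𝓝 0) := by
  have hle : ∀ {r : (n : ℕ) → Ω n → ℝ}, (∀ n, IsProbC (r n)) → ∀ n (A : Set (Ω n)),
      probOf (r n) A ≤ 1 := by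
    intro r hr n A
    rw [probOf_eq_sum, ← (hr n).sum_eq_one]
    refine sum_le_sum fun x _ => ?_
    split_ifs
    · exact le_rfl
    · exact (hr n).1 x
  have key : ∀ ε > 0, Tendsto (fun n => probOf (q n) {x | g n x ≤ ε}) atTop (𝓝 1) := by
    intro ε hε
    refine (h _).1 ?_
    have hlow : ∀ n, 1 - (∑ x, p n x * g n x) / ε ≤ probOf (p n) {x | g n x ≤ ε} := by
      intro n
      rw [probOf_eq_sum, ← (hp n).sum_eq_one, sum_div, ← sum_sub_distrib]
      refine sum_le_sum fun x _ => ?_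
      have h0 := (hp n).1 x
      simp only [Set.mem_ofPred_eq]
      split_ifs with hx
      · have : 0 ≤ p n x * g n x / ε := div_nonneg (mul_nonneg h0 (hg0 n x)) hε.le
        linarith
      · have : p n x ≤ p n x * g n x / ε := by
          rw [le_div_iff₀ hε]
          exact mul_le_mul_of_nonneg_left (not_le.1 hx).le h0
        linarith
    refine tendsto_of_tendsto_of_tendsto_of_le_of_le ?_ tendsto_const_nhds hlow
      fun n => hle hp n _
    simpa using (hpg.div_const ε).const_sub 1
  rw [Metric.tendsto_atTop']
  intro ε hε
  have hev := (key (ε / 2) (by positivity)).eventually_const_lt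
    (show 1 - ε / 2 < 1 by linarith)
  obtain ⟨N, hN⟩ := eventually_atTop.1 hev
  refine ⟨N, fun n hn => ?_⟩
  have h1 := hN n hn.le
  have h2 : ∑ x, q n x * g n x ≤ ε / 2 + (1 - probOf (q n) {x | g n x ≤ ε / 2}) := by
    rw [probOf_eq_sum]
    have : ε / 2 + (1 - ∑ x, if x ∈ {x | g n x ≤ ε / 2} then q n x else 0) =
        ∑ x, (q n x * (ε / 2) + (q n x - if x ∈ {x | g n x ≤ ε / 2} then q n x else 0)) := by
      rw [sum_add_distrib, sum_sub_distrib, ← sum_mul, (hq n).sum_eq_one, one_mul]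
    rw [this]
    refine sum_le_sum fun x _ => ?_
    have h0 := (hq n).1 x
    simp only [Set.mem_ofPred_eq]
    split_ifs with hx
    · have := mul_le_mul_of_nonneg_left hx h0
      linarith
    · have := mul_le_mul_of_nonneg_left (hg1 n x) h0
      have : 0 ≤ q n x * (ε / 2) := by positivity
      linarith
  have h3 : 0 ≤ ∑ x, q n x * g n x :=
    sum_nonneg fun x _ => mul_nonneg ((hq n).1 x) (hg0 n x)
  rw [Real.dist_eq, sub_zero, abs_of_nonneg h3]
  linarith

lemma Contiguous.tendsto_tilted (h : Contiguous p q) (hp : ∀ n, IsProbC (p n))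
    (hq : ∀ n, IsProbC (q n)) {Z W : (n : ℕ) → Ω n → ℝ} (hW : ∀ n x, 0 ≤ W n x)
    (hWZ : ∀ n x, W n x ≤ Z n x) {C : ℝ} (hC : 0 < C)
    (hZ : ∀ᶠ n in atTop, ∀ x y, (p n x ≠ 0 ∨ q n x ≠ 0) → (p n y ≠ 0 ∨ q n y ≠ 0) →
      Z n x ≤ C * Z n y)
    (ht : Tendsto (fun n => (∑ x, p n x * W n x) / ∑ x, p n x * Z n x) atTop (𝓝 1)) :
    Tendsto (fun n => (∑ x, q n x * W n x) / ∑ x, q n x * Z n x) atTop (𝓝 1) := by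
  have hZ0 : ∀ n x, 0 ≤ Z n x := fun n x => (hW n x).trans (hWZ n x)
  set g : (n : ℕ) → Ω n → ℝ := fun n x => (Z n x - W n x) / Z n x with hg
  have hg0 : ∀ n x, 0 ≤ g n x := fun n x => div_nonneg (sub_nonneg.2 (hWZ n x)) (hZ0 n x)
  have hg1 : ∀ n x, g n x ≤ 1 := fun n x =>
    div_le_one_of_le₀ (by linarith [hW n x]) (hZ0 n x)
  have hgZ : ∀ n x, g n x * Z n x = Z n x - W n x := by
    intro n x
    rcases (hZ0 n x).eq_or_lt with h0 | h0
    · have h1 := hW n x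
      have h2 := hWZ n x
      rw [← h0] at h2 ⊢
      linarith
    · exact div_mul_cancel₀ _ h0.ne'
  have hratio : ∀ (r : (n : ℕ) → Ω n → ℝ) n, 0 < ∑ x, r n x * Z n x →
      (∑ x, r n x * (g n x * Z n x)) / (∑ x, r n x * Z n x) =
      1 - (∑ x, r n x * W n x) / ∑ x, r n x * Z n x := by
    intro r n h0
    simp_rw [hgZ, mul_sub, sum_sub_distrib]
    rw [sub_div, div_self h0.ne']
  have hpos : ∀ᶠ n in atTop, 0 < ∑ x, p n x * Z n x := by
    filter_upwards [ht.eventually_const_lt (show (1 / 2 : ℝ) < 1 by norm_num)] with n hn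
    refine lt_of_le_of_ne (sum_nonneg fun x _ => mul_nonneg ((hp n).1 x) (hZ0 n x)) fun h0 => ?_
    rw [← h0, div_zero] at hn
    norm_num at hn
  have hposq : ∀ᶠ n in atTop, 0 < ∑ x, q n x * Z n x := by
    filter_upwards [hpos, hZ] with n h1 h2
    obtain ⟨x, -, hx⟩ := exists_ne_zero_of_sum_ne_zero h1.ne'
    obtain ⟨y, -, hy⟩ := exists_ne_zero_of_sum_ne_zero
      (show ∑ y, q n y ≠ 0 by rw [(hq n).sum_eq_one]; exact one_ne_zero)
    refine sum_pos' (fun x _ => mul_nonneg ((hq n).1 x) (hZ0 n x)) ⟨y, mem_univ _, ?_⟩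
    refine mul_pos (lt_of_le_of_ne ((hq n).1 y) hy.symm) ?_
    have h3 := h2 x y (Or.inl (left_ne_zero_of_mul hx)) (Or.inr hy)
    have h4 : 0 < Z n x := lt_of_le_of_ne (hZ0 n x) (right_ne_zero_of_mul hx).symm
    exact pos_of_mul_pos_right (h4.trans_le h3) hC.le
  have hpg : Tendsto (fun n => ∑ x, p n x * g n x) atTop (𝓝 0) := by
    have hlim : Tendsto (fun n => C * (1 - (∑ x, p n x * W n x) / ∑ x, p n x * Z n x))
        atTop (𝓝 0) := by
      simpa using (ht.const_sub 1).const_mul C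
    refine tendsto_of_tendsto_of_tendsto_of_le_of_le' tendsto_const_nhds hlim
      (Eventually.of_forall fun n => sum_nonneg fun x _ => mul_nonneg ((hp n).1 x) (hg0 n x)) ?_
    filter_upwards [hpos, hZ] with n h1 h2
    rw [← hratio p n h1, ← mul_div_assoc, le_div_iff₀ h1]
    exact (hp n).sum_mul_mul_sum_mul_le (hg0 n) fun x y hx hy => h2 x y (Or.inl hx) (Or.inl hy)
  have hqg := h.tendsto_sum_mul_zero hp hq hg0 hg1 hpg
  have hq0 : Tendsto (fun n => (∑ x, q n x * (g n x * Z n x)) / ∑ x, q n x * Z n x)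
      atTop (𝓝 0) := by
    refine tendsto_of_tendsto_of_tendsto_of_le_of_le' tendsto_const_nhds
      (by simpa using hqg.const_mul C) (Eventually.of_forall fun n => div_nonneg
        (sum_nonneg fun x _ => mul_nonneg ((hq n).1 x) (mul_nonneg (hg0 n x) (hZ0 n x)))
        (sum_nonneg fun x _ => mul_nonneg ((hq n).1 x) (hZ0 n x))) ?_
    filter_upwards [hposq, hZ] with n h1 h2
    rw [div_le_iff₀ h1, mul_assoc]
    exact (hq n).sum_mul_mul_le (hg0 n) fun x y hx hy => h2 x y (Or.inr hx) (Or.inr hy)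
  have hlim : Tendsto (fun n => 1 - (∑ x, q n x * (g n x * Z n x)) / ∑ x, q n x * Z n x)
      atTop (𝓝 1) := by
    simpa using hq0.const_sub 1
  refine hlim.congr' ?_
  filter_upwards [hposq] with n h1
  rw [hratio q n h1]
  ring

end Contiguity

section Superposition

open Finset
open scoped Classical

variable {n : ℕ}

/-- The `q`-mass of the graphs edge-disjoint from `H` whose union with `H` lies in `A`. -/
noncomputable def disjointMass (q : SimpleGraph (Fin n) → ℝ) (A : Set (SimpleGraph (Fin n)))
    (H : SimpleGraph (Fin n)) : ℝ :=
  ∑ T, if Disjoint H T ∧ H ⊔ T ∈ A then q T else 0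

lemma disjointMass_nonneg {q : SimpleGraph (Fin n) → ℝ} (hq : ∀ T, 0 ≤ q T)
    (A : Set (SimpleGraph (Fin n))) (H : SimpleGraph (Fin n)) : 0 ≤ disjointMass q A H :=
  sum_nonneg fun T _ => by
    split_ifs
    exacts [hq T, le_rfl]

lemma disjointMass_le_univ {q : SimpleGraph (Fin n) → ℝ} (hq : ∀ T, 0 ≤ q T)
    (A : Set (SimpleGraph (Fin n))) (H : SimpleGraph (Fin n)) :
    disjointMass q A H ≤ disjointMass q Set.univ H :=
  sum_le_sum fun T _ => by
    have := hq T
    simp only [Set.mem_univ, and_true]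
    split_ifs <;> first | linarith | tauto

lemma sum_oplusMass (p q : SimpleGraph (Fin n) → ℝ) (A : Set (SimpleGraph (Fin n))) :
    (∑ G, if G ∈ A then oplusMass p q G else 0) = ∑ H, p H * disjointMass q A H := by
  simp only [oplusMass, tsum_fintype, disjointMass, mul_sum]
  rw [← Fintype.sum_prod_type' (f := fun H T =>
    p H * if Disjoint H T ∧ H ⊔ T ∈ A then q T else 0)]
  calc _ = ∑ G, ∑ P : SimpleGraph (Fin n) × SimpleGraph (Fin n), if P.1 ⊔ P.2 = G then
        (p P.1 * if Disjoint P.1 P.2 ∧ P.1 ⊔ P.2 ∈ A then q P.2 else 0) else 0 := by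
        refine sum_congr rfl fun G _ => ?_
        split_ifs with hG
        · refine sum_congr rfl fun P _ => ?_
          by_cases h : P.1 ⊔ P.2 = G
          · simp [h, hG]
          · simp [h]
        · refine (sum_eq_zero fun P _ => ?_).symm
          by_cases h : P.1 ⊔ P.2 = G
          · simp [h, hG]
          · simp [h]
    _ = _ := by
        rw [sum_comm]
        exact sum_congr rfl fun P _ => by simp

lemma probOf_oplus (p q : SimpleGraph (Fin n) → ℝ) (A : Set (SimpleGraph (Fin n))) :
    probOf (oplus p q) A =
      (∑ H, p H * disjointMass q A H) / ∑ H, p H * disjointMass q Set.univ H := by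
  rw [probOf_eq_sum, ← sum_oplusMass, ← sum_oplusMass, sum_div]
  refine sum_congr rfl fun G _ => ?_
  rw [oplus, tsum_fintype]
  simp only [Set.mem_univ, if_true]
  split_ifs <;> simp

lemma mu_nonneg (n d : ℕ) (G : SimpleGraph (Fin n)) : 0 ≤ mu n d G := by
  unfold mu
  split_ifs <;> positivity

lemma oplusFoldMass_nonneg {m : ℕ} {p : Fin m → SimpleGraph (Fin n) → ℝ}
    (hp : ∀ i G, 0 ≤ p i G) (G : SimpleGraph (Fin n)) : 0 ≤ oplusFoldMass m p G :=
  tsum_nonneg fun f => by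
    split_ifs
    exacts [prod_nonneg fun i _ => hp i _, le_rfl]

lemma oplusFold_nonneg {m : ℕ} {p : Fin m → SimpleGraph (Fin n) → ℝ}
    (hp : ∀ i G, 0 ≤ p i G) (G : SimpleGraph (Fin n)) : 0 ≤ oplusFold m p G :=
  div_nonneg (oplusFoldMass_nonneg hp G) (tsum_nonneg fun H => oplusFoldMass_nonneg hp H)

/-- The mass of the graphs avoiding `H` under a superposition of uniform regular graphs is, up to
a factor not depending on `H`, the number of tuples of regular graphs avoiding `H`. -/
lemma exists_disjointMass_oplusFold_mu (m : ℕ) (d : Fin m → ℕ) :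
    ∃ c : ℝ, 0 ≤ c ∧ ∀ H : SimpleGraph (Fin n),
      disjointMass (oplusFold m fun i => mu n (d i)) Set.univ H =
        c * (regularTuples d H).card := by
  set w : ℝ := ∏ i, (Nat.card {H : SimpleGraph (Fin n) // IsRegularGraph H (d i)} : ℝ)⁻¹
  set s : ℝ := ∑' H, oplusFoldMass m (fun i => mu n (d i)) H
  refine ⟨w / s, div_nonneg (prod_nonneg fun i _ => by positivity) (tsum_nonneg fun H =>
    oplusFoldMass_nonneg (fun i => mu_nonneg n (d i)) H), fun H => ?_⟩
  have hw : ∀ f : Fin m → SimpleGraph (Fin n), ∏ i, mu n (d i) (f i) =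
      if ∀ i, IsRegularGraph (f i) (d i) then w else 0 := by
    intro f
    split_ifs with hf
    · exact prod_congr rfl fun i _ => by simp [mu, hf i]
    · push Not at hf
      obtain ⟨i, hi⟩ := hf
      exact prod_eq_zero (mem_univ i) (by simp [mu, hi])
  have hmass : (∑ T, if Disjoint H T then oplusFoldMass m (fun i => mu n (d i)) T else 0) =
      w * (regularTuples d H).card := by
    simp only [oplusFoldMass, tsum_fintype, hw]
    calc _ = ∑ T, ∑ f : Fin m → SimpleGraph (Fin n),
          if (⨆ i, f i) = T then (if f ∈ regularTuples d H then w else 0) else 0 := by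
          refine sum_congr rfl fun T _ => ?_
          split_ifs with hT
          · refine sum_congr rfl fun f _ => ?_
            by_cases h : ⨆ i, f i = T
            · rw [← h, disjoint_iSup_iff] at hT
              simp [h, hT, regularTuples, ite_and]
            · simp [h]
          · refine (sum_eq_zero fun f _ => ?_).symm
            by_cases h : ⨆ i, f i = T
            · rw [← h, disjoint_iSup_iff] at hT
              simp [hT, regularTuples]
            · simp [h]
      _ = ∑ f : Fin m → SimpleGraph (Fin n), if f ∈ regularTuples d H then w else 0 := by
          rw [sum_comm]
          exact sum_congr rfl fun f _ => by simp
      _ = _ := by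
          rw [← sum_filter, sum_const, nsmul_eq_mul, mul_comm, filter_mem_eq_inter, univ_inter]
  rw [div_mul_eq_mul_div, ← hmass, sum_div, disjointMass]
  refine sum_congr rfl fun T _ => ?_
  simp only [Set.mem_univ, and_true, oplusFold]
  split_ifs <;> simp [s]

lemma disjointMass_oplusFold_mu_le {D m x : ℕ} (hn : 100 * D ≤ n) (hD3 : D ^ 3 ≤ n)
    (d : Fin m → ℕ) (hd : ∀ i, 1 ≤ d i) (hD : x + ∑ i, d i ≤ D) {X Y : SimpleGraph (Fin n)}
    (hX : IsRegularGraph X x) (hY : IsRegularGraph Y x) :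
    disjointMass (oplusFold m fun i => mu n (d i)) Set.univ X ≤
      Real.exp 34 * disjointMass (oplusFold m fun i => mu n (d i)) Set.univ Y := by
  obtain ⟨c, hc, h⟩ := exists_disjointMass_oplusFold_mu (n := n) m d
  rw [h, h]
  have h1 := card_regularTuples_le hn d hd x hD X Y hX hY
  have h2 : 34 * (D : ℝ) ^ 2 * (∑ i, d i : ℕ) / n ≤ 34 := by
    refine div_le_of_le_mul₀ (by positivity) (by norm_num) ?_
    have h3 : ((∑ i, d i : ℕ) : ℝ) ≤ D := by
      have : ∑ i, d i ≤ D := by omega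
      exact_mod_cast this
    have h4 : (D : ℝ) ^ 3 ≤ n := by exact_mod_cast hD3
    have := mul_le_mul_of_nonneg_left h3 (sq_nonneg (D : ℝ))
    linarith
  calc c * ((regularTuples d X).card : ℝ) ≤
        c * (Real.exp 34 * (regularTuples d Y).card) := by
        refine mul_le_mul_of_nonneg_left (h1.trans ?_) hc
        gcongr
    _ = _ := by ring

lemma sum_univ_eq_zero_add_sum_succ {k : ℕ} (hk : 1 ≤ k) (d : Fin k → ℕ) :
    ∑ i, d i = d ⟨0, hk⟩ +
      ∑ i : Fin (k - 1), d ⟨i.1 + 1, by have := i.isLt; omega⟩ := by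
  obtain ⟨m, rfl⟩ : ∃ m, k = m + 1 := ⟨k - 1, by omega⟩
  exact Fin.sum_univ_succ d

end Superposition

/-- For sequences `k = k(n) ≥ 2` and degrees `d_1(n), …, d_{k(n)}(n) ≥ 1`
with `d_i n` even and `(∑ d_i)^3 ≤ n` (for all large `n`), and probability measures
`η_n, η̃_n` on `𝒢_{d_1}(n)`, setting `τ_n = μ_{d_2,n} ⊕ ⋯ ⊕ μ_{d_k,n}`: if `(η_n)` and
`(η̃_n)` are contiguous, then `(η_n ⊕ τ_n)` and `(η̃_n ⊕ τ_n)` are contiguous. -/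
theorem statement_10
    (k : ℕ → ℕ) (hk : ∀ n, 2 ≤ k n)
    (d : (n : ℕ) → Fin (k n) → ℕ)
    (η η' : (n : ℕ) → SimpleGraph (Fin n) → ℝ)
    (hη : ∀ n, IsProbC (η n)) (hη' : ∀ n, IsProbC (η' n))
    (hcond : ∀ᶠ n in atTop,
      (∀ i, 1 ≤ d n i) ∧
      (∀ i, Even (d n i * n)) ∧
      (∑ i, d n i) ^ 3 ≤ n ∧
      (∀ G, η n G ≠ 0 → IsRegularGraph G (d n ⟨0, by have := hk n; omega⟩)) ∧
      (∀ G, η' n G ≠ 0 → IsRegularGraph G (d n ⟨0, by have := hk n; omega⟩)))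
    (hc : Contiguous η η') :
    Contiguous
      (fun n => oplus (η n) (oplusFold (k n - 1) (fun i => mu n (d n ⟨i.1 + 1, by
        have := i.isLt; omega⟩))))
      (fun n => oplus (η' n) (oplusFold (k n - 1) (fun i => mu n (d n ⟨i.1 + 1, by
        have := i.isLt; omega⟩)))) := by
  have hmain : ∀ p q : (n : ℕ) → SimpleGraph (Fin n) → ℝ, (∀ n, IsProbC (p n)) →
      (∀ n, IsProbC (q n)) →
      (∀ᶠ n in atTop, (∀ i, 1 ≤ d n i) ∧ (∑ i, d n i) ^ 3 ≤ n ∧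
        (∀ G, p n G ≠ 0 → IsRegularGraph G (d n ⟨0, by have := hk n; omega⟩)) ∧
        (∀ G, q n G ≠ 0 → IsRegularGraph G (d n ⟨0, by have := hk n; omega⟩))) →
      Contiguous p q → ∀ A : (n : ℕ) → Set (SimpleGraph (Fin n)),
      Tendsto (fun n => probOf (oplus (p n) (oplusFold (k n - 1) fun i =>
        mu n (d n ⟨i.1 + 1, by have := i.isLt; omega⟩))) (A n)) atTop (𝓝 1) →
      Tendsto (fun n => probOf (oplus (q n) (oplusFold (k n - 1) fun i =>
        mu n (d n ⟨i.1 + 1, by have := i.isLt; omega⟩))) (A n)) atTop (𝓝 1) := by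
    intro p q hp hq hreg hpq A
    simp only [probOf_oplus]
    have hτ : ∀ n G, 0 ≤ oplusFold (n := n) (k n - 1) (fun i =>
        mu n (d n ⟨i.1 + 1, by have := i.isLt; omega⟩)) G := fun n G =>
      oplusFold_nonneg (fun i G => mu_nonneg _ _ G) G
    refine hpq.tendsto_tilted hp hq (fun n H => disjointMass_nonneg (hτ n) (A n) H)
      (fun n H => disjointMass_le_univ (hτ n) (A n) H) (Real.exp_pos 34) ?_
    filter_upwards [hreg, eventually_ge_atTop 1000] with n ⟨h1, h2, h3, h4⟩ hn x y hx hy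
    have hx' := hx.elim (h3 x) (h4 x)
    have hy' := hy.elim (h3 y) (h4 y)
    refine disjointMass_oplusFold_mu_le (D := ∑ i, d n i) ?_ h2 _ (fun i => h1 _) ?_ hx' hy'
    · by_contra! hlt
      generalize ∑ i, d n i = D at h2 hlt
      have : D < 10 := by
        by_contra! h10
        nlinarith [Nat.mul_le_mul h10 h10, sq D, pow_succ D 2]
      omega
    · exact (sum_univ_eq_zero_add_sum_succ (one_le_two.trans (hk n)) (d n)).ge
  intro A
  refine ⟨hmain η η' hη hη' (hcond.mono fun n h => ⟨h.1, h.2.2⟩) hc A,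
    hmain η' η hη' hη (hcond.mono fun n h => ⟨h.1, h.2.2.1, h.2.2.2.2, h.2.2.2.1⟩)
      (fun B => (hc B).symm) A⟩
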